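/- Let k ≥ 3 be an integer and let χ1, χ2 be primitive Dirichlet characters modulo q1 and q2 (the trivial character modulo 1 is counted as primitive) with χ1(−1)·χ2(−1) = (−1)^k. Set C = (q2/(2π))^k · (k−1)! · L(k, χ1·χ2), where χ1·χ2 is the product character modulo q1·q2 and L denotes the Dirichlet L-function. Then for every z in the upper half-plane, C · E_{χ1,χ2,k}(z) = [q1 = 1] · C + i^{−k}·τ(χ2) · ∑_{n=1}^{∞} ( ∑_{a,b ≥ 1, ab = n} χ1(a)·conj(χ2)(b)·b^{k−1} ) · e^{2πi n z}, where [q1 = 1] equals 1 if q1 = 1 and 0 otherwise. -/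

import Mathlib

open Complex

/-- Holomorphic Eisenstein series of weight `k` attached to `(χ1, χ2)`. -/
noncomputable def holEisenstein {q1 q2 : ℕ} (k : ℕ)
    (χ1 : DirichletCharacter ℂ q1) (χ2 : DirichletCharacter ℂ q2) (z : ℂ) : ℂ :=
  (1 / 2) * ∑' p : ℤ × ℤ,
    if Int.gcd p.1 p.2 = 1 then
      χ1 p.1 * χ2 p.2 * ((p.1 : ℂ) * q2 * z + p.2) ^ (-(k : ℤ))
    else 0

/-- Gauss sum `τ(χ) = ∑_{r mod q} χ(r) e^{2πi r/q}`. -/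
noncomputable def gaussSumChar {q : ℕ} [NeZero q] (χ : DirichletCharacter ℂ q) : ℂ :=
  ∑ r : ZMod q, χ r * Complex.exp (2 * Real.pi * I * r.val / q)

/-- Dirichlet series `L(w,χ) = ∑_{n ≥ 1} χ(n) n^{-w}` (convergent for `Re w > 1`). -/
noncomputable def LSer {q : ℕ} (χ : DirichletCharacter ℂ q) (w : ℂ) : ℂ :=
  ∑' n : ℕ, χ n * (n : ℂ) ^ (-w)

lemma aux_char_prod {q1 q2 : ℕ} [NeZero q1] [NeZero q2]
    (χ1 : DirichletCharacter ℂ q1) (χ2 : DirichletCharacter ℂ q2) (n : ℕ) :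
    ((DirichletCharacter.changeLevel (dvd_mul_right q1 q2) χ1) *
        (DirichletCharacter.changeLevel (dvd_mul_left q2 q1) χ2)) n = χ1 n * χ2 n := by
  rw [MulChar.mul_apply]
  by_cases h : n.Coprime (q1 * q2)
  · have h' : IsCoprime (n : ℤ) ((q1 * q2 : ℕ) : ℤ) := Nat.isCoprime_iff_coprime.mpr h
    have h1 := DirichletCharacter.changeLevel_eq_cast_of_dvd' χ1 (dvd_mul_right q1 q2) h'
    have h2 := DirichletCharacter.changeLevel_eq_cast_of_dvd' χ2 (dvd_mul_left q2 q1) h'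
    simp only [Int.cast_natCast] at h1 h2
    rw [h1, h2]
  · have hn : ¬ IsUnit (n : ZMod (q1 * q2)) := by rwa [ZMod.isUnit_iff_coprime]
    rw [MulChar.map_nonunit _ hn, zero_mul]
    rw [Nat.coprime_mul_iff_right, not_and_or] at h
    rcases h with h | h
    · rw [MulChar.map_nonunit χ1 (by rwa [ZMod.isUnit_iff_coprime]), zero_mul]
    · rw [MulChar.map_nonunit χ2 (by rwa [ZMod.isUnit_iff_coprime]), mul_zero]

lemma aux_gauss {q : ℕ} [NeZero q] (χ : DirichletCharacter ℂ q) (hχ : χ.IsPrimitive) (m : ℕ) :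
    ∑ r : ZMod q, χ r * Complex.exp (2 * Real.pi * I * r.val / q) ^ m =
      (starRingEnd ℂ) (χ m) * gaussSumChar χ := by
  have h := gaussSum_mulShift_of_isPrimitive (ZMod.stdAddChar (N := q)) hχ (m : ZMod q)
  have hg : gaussSumChar χ = gaussSum χ (ZMod.stdAddChar (N := q)) := by
    simp only [gaussSumChar, gaussSum, ZMod.stdAddChar_apply, ZMod.toCircle_apply]
  rw [hg, starRingEnd_apply, MulChar.star_apply', ← h]
  simp only [gaussSum, AddChar.mulShift_spec', ZMod.stdAddChar_apply, ZMod.toCircle_apply]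

lemma aux_sum_fin {q : ℕ} [NeZero q] (f : ℕ → ℂ) :
    ∑ r : ZMod q, f r.val = ∑ r : Fin q, f r := by
  cases q with
  | zero => exact absurd rfl (NeZero.ne 0)
  | succ n => rfl

lemma aux_inner {q : ℕ} [NeZero q] (k : ℕ) (hk : 3 ≤ k) (χ : DirichletCharacter ℂ q)
    (hχ : χ.IsPrimitive) (w : ℂ) (hw : 0 < w.im) :
    ∑' d : ℤ, χ d * ((q : ℂ) * w + d) ^ (-(k : ℤ)) =
      ((-2 * Real.pi * I) ^ k / (k - 1).factorial) * ((q : ℂ) ^ k)⁻¹ * gaussSumChar χ *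
        ∑' m : ℕ+, (starRingEnd ℂ) (χ ((m : ℕ) : ZMod q)) * ((m : ℕ) : ℂ) ^ (k - 1) *
          Complex.exp (2 * Real.pi * I * w) ^ (m : ℕ) := by
  have hq : (q : ℂ) ≠ 0 := by exact_mod_cast NeZero.ne q
  have hsum : Summable fun d : ℤ ↦ χ d * ((q : ℂ) * w + d) ^ (-(k : ℤ)) := by
    have := EisensteinSeries.linear_right_summable ((q : ℂ) * w) 1 (k := k) (by omega)
    refine Summable.of_norm_bounded this.norm fun d ↦ ?_
    rw [norm_mul]
    refine (mul_le_of_le_one_left (norm_nonneg _) (DirichletCharacter.norm_le_one χ _)).trans ?_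
    simp
  have hterm (r : Fin q) (n : ℤ) :
      χ (((Int.divModEquiv q).symm (n, r) : ℤ)) *
        ((q : ℂ) * w + ((Int.divModEquiv q).symm (n, r) : ℤ)) ^ (-(k : ℤ)) =
      χ ((r : ℕ) : ZMod q) * ((q : ℂ) ^ k)⁻¹ * (1 / ((w + (r : ℕ) / q) + n) ^ k) := by
    have : (q : ℂ) * w + ((n * q + (r : ℕ) : ℤ) : ℂ) = q * ((w + (r : ℕ) / q) + n) := by
      push_cast; field_simp; ring
    simp only [Int.divModEquiv, Equiv.coe_fn_symm_mk]
    rw [this, zpow_neg, zpow_natCast, mul_pow, mul_inv]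
    simp [mul_assoc]
  rw [← (Int.divModEquiv q).symm.tsum_eq]
  have hsum' := (Int.divModEquiv q).symm.summable_iff.mpr hsum
  rw [← (Equiv.prodComm _ _).tsum_eq]
  have hsum'' := (Equiv.prodComm (Fin q) ℤ).summable_iff.mpr hsum'
  rw [Summable.tsum_prod (by exact hsum'')]
  simp only [Equiv.prodComm_apply, Prod.swap_prod_mk, hterm, tsum_mul_left]
  have him (r : Fin q) : 0 < (w + ((r : ℕ) : ℂ) / q).im := by
    have : ((r : ℕ) : ℂ) / q = (((r : ℕ) / q : ℝ) : ℂ) := by push_cast; rfl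
    rw [this, Complex.add_im, Complex.ofReal_im]; simpa using hw
  have H (r : Fin q) := EisensteinSeries.qExpansion_identity_pnat (k := k - 1) (by omega)
    ⟨w + ((r : ℕ) : ℂ) / q, him r⟩
  simp only [show k - 1 + 1 = k by omega] at H
  simp only [H, tsum_fintype]
  have hS (r : Fin q) : Summable fun m : ℕ+ ↦ ((m : ℕ) : ℂ) ^ (k - 1) *
      Complex.exp (2 * Real.pi * I * (w + ((r : ℕ) : ℂ) / q)) ^ (m : ℕ) := by
    have := summable_pow_mul_cexp (k - 1) 1 ⟨w + ((r : ℕ) : ℂ) / q, him r⟩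
    simp only [PNat.val_ofNat, Nat.cast_one, mul_one] at this
    exact this.comp_injective PNat.coe_injective
  rw [← tsum_mul_left]
  calc _ = ∑ r : Fin q, ∑' m : ℕ+, (χ ((r : ℕ) : ZMod q) * ((q : ℂ) ^ k)⁻¹ *
        ((-2 * Real.pi * I) ^ k / (k - 1).factorial)) * (((m : ℕ) : ℂ) ^ (k - 1) *
      Complex.exp (2 * Real.pi * I * (w + ((r : ℕ) : ℂ) / q)) ^ (m : ℕ)) := by
        refine Finset.sum_congr rfl fun r _ ↦ ?_
        rw [tsum_mul_left]
        exact (mul_assoc _ _ _).symm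
    _ = _ := by
        rw [← Summable.tsum_finsetSum (fun r _ ↦ (hS r).mul_left _)]
        refine tsum_congr fun m ↦ ?_
        have hg := aux_gauss χ hχ m
        have := aux_sum_fin (q := q)
          (fun r ↦ χ (r : ZMod q) * Complex.exp (2 * Real.pi * I * r / q) ^ (m : ℕ))
        simp only [ZMod.natCast_zmod_val] at this
        rw [this] at hg
        rw [show ((-2 * Real.pi * I) ^ k / (k - 1).factorial) * ((q : ℂ) ^ k)⁻¹ * gaussSumChar χ *
          ((starRingEnd ℂ) (χ ((m : ℕ) : ZMod q)) * ((m : ℕ) : ℂ) ^ (k - 1) *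
          Complex.exp (2 * Real.pi * I * w) ^ (m : ℕ)) =
          ((starRingEnd ℂ) (χ ((m : ℕ) : ZMod q)) * gaussSumChar χ) *
          (((-2 * Real.pi * I) ^ k / (k - 1).factorial) * ((q : ℂ) ^ k)⁻¹ * ((m : ℕ) : ℂ) ^ (k - 1) *
          Complex.exp (2 * Real.pi * I * w) ^ (m : ℕ)) by ring, ← hg, Finset.sum_mul]
        refine Finset.sum_congr rfl fun r _ ↦ ?_
        rw [mul_add, Complex.exp_add, mul_pow, mul_div_assoc]
        ring

lemma aux_double {q1 q2 : ℕ} [NeZero q1] [NeZero q2] (k : ℕ)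
    (χ1 : DirichletCharacter ℂ q1) (χ2 : DirichletCharacter ℂ q2) (z : ℂ) (hz : 0 < z.im) :
    ∑' c : ℕ+, χ1 ((c : ℕ) : ZMod q1) *
      ∑' m : ℕ+, (starRingEnd ℂ) (χ2 ((m : ℕ) : ZMod q2)) * ((m : ℕ) : ℂ) ^ (k - 1) *
          Complex.exp (2 * Real.pi * I * ((c : ℕ) * z)) ^ (m : ℕ) =
      ∑' n : ℕ,
            (∑ d ∈ (n + 1).divisors,
              χ1 (((n + 1) / d : ℕ)) * (starRingEnd ℂ) (χ2 d) * (d : ℂ) ^ (k - 1)) *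
              Complex.exp (2 * Real.pi * I * (n + 1) * z) := by
  have hr : ‖Complex.exp (2 * Real.pi * I * z)‖ < 1 :=
    UpperHalfPlane.norm_exp_two_pi_I_lt_one ⟨z, hz⟩
  set F : ℕ → ℕ → ℂ := fun a b ↦ χ1 (a : ZMod q1) * (starRingEnd ℂ) (χ2 (b : ZMod q2)) *
    (b : ℂ) ^ (k - 1) * Complex.exp (2 * Real.pi * I * z) ^ (a * b) with hF
  have hs : Summable fun p : ℕ+ × ℕ+ ↦ F p.1 p.2 := by
    refine Summable.of_norm_bounded (summable_prod_mul_pow (k - 1) hr).norm fun p ↦ ?_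
    simp only [hF]
    rw [mul_assoc, norm_mul, norm_mul, RCLike.norm_conj]
    refine mul_le_of_le_one_left (norm_nonneg _) ?_
    exact mul_le_one₀ (DirichletCharacter.norm_le_one χ1 _) (norm_nonneg _)
      (DirichletCharacter.norm_le_one χ2 _)
  calc _ = ∑' (a : ℕ+) (b : ℕ+), F a b := by
        refine tsum_congr fun a ↦ ?_
        rw [← tsum_mul_left]
        refine tsum_congr fun b ↦ ?_
        simp only [hF]
        rw [pow_mul, ← Complex.exp_nat_mul (2 * Real.pi * I * z) a,
          show ((a : ℕ) : ℂ) * (2 * Real.pi * I * z) = 2 * Real.pi * I * ((a : ℕ) * z) by ring]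
        ring
    _ = ∑' p : ℕ+ × ℕ+, F p.1 p.2 := hs.tsum_prod.symm
    _ = ∑' n : ℕ+, ∑ x ∈ (n : ℕ).divisorsAntidiagonal, F x.1 x.2 := by
        rw [← sigmaAntidiagonalEquivProd.tsum_eq]
        have hs' := sigmaAntidiagonalEquivProd.summable_iff.mpr hs
        refine hs'.tsum_sigma.trans ?_
        refine tsum_congr fun n ↦ ?_
        rw [tsum_fintype, ← Finset.sum_attach (n : ℕ).divisorsAntidiagonal]
        rfl
    _ = _ := by
        rw [tsum_pnat_eq_tsum_succ (f := fun n ↦ ∑ x ∈ n.divisorsAntidiagonal, F x.1 x.2)]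
        refine tsum_congr fun n ↦ ?_
        rw [Nat.sum_divisorsAntidiagonal' (f := F), Finset.sum_mul]
        refine Finset.sum_congr rfl fun d hd ↦ ?_
        simp only [hF]
        rw [Nat.div_mul_cancel (Nat.dvd_of_mem_divisors hd), ← Complex.exp_nat_mul]
        congr 2
        push_cast; ring

lemma aux_summable {q1 q2 : ℕ} [NeZero q1] [NeZero q2] (k : ℕ) (hk : 3 ≤ k)
    (χ1 : DirichletCharacter ℂ q1) (χ2 : DirichletCharacter ℂ q2) (w : ℂ) (hw : 0 < w.im) :
    Summable fun p : ℤ × ℤ ↦ ‖χ1 p.1 * χ2 p.2 * ((p.1 : ℂ) * w + p.2) ^ (-(k : ℤ))‖ := by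
  refine Summable.of_nonneg_of_le (fun _ ↦ norm_nonneg _) (fun p ↦ ?_)
    (summable_prod_eisSummand hk ⟨w, hw⟩).norm
  rw [norm_mul, norm_mul]
  refine (mul_le_of_le_one_left (norm_nonneg _) (mul_le_one₀ (DirichletCharacter.norm_le_one χ1 _)
    (norm_nonneg _) (DirichletCharacter.norm_le_one χ2 _))).trans ?_
  simp [EisensteinSeries.eisSummand]

lemma aux_coprime {q1 q2 : ℕ} [NeZero q1] [NeZero q2] (k : ℕ) (hk : 3 ≤ k)
    (χ1 : DirichletCharacter ℂ q1) (χ2 : DirichletCharacter ℂ q2) (w : ℂ) (hw : 0 < w.im) :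
    (∑' n : ℕ, χ1 n * χ2 n * (n : ℂ) ^ (-(k : ℤ))) * (∑' p : ℤ × ℤ,
      if Int.gcd p.1 p.2 = 1 then χ1 p.1 * χ2 p.2 * ((p.1 : ℂ) * w + p.2) ^ (-(k : ℤ)) else 0) =
    ∑' p : ℤ × ℤ, χ1 p.1 * χ2 p.2 * ((p.1 : ℂ) * w + p.2) ^ (-(k : ℤ)) := by
  have hs := aux_summable k hk χ1 χ2 w hw
  have h1 : Summable fun n : ℕ ↦ ‖χ1 n * χ2 n * (n : ℂ) ^ (-(k : ℤ))‖ := by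
    refine Summable.of_nonneg_of_le (fun _ ↦ norm_nonneg _) (fun n ↦ ?_)
      (Real.summable_nat_pow_inv (p := k).mpr (by omega))
    rw [norm_mul, norm_mul]
    refine (mul_le_of_le_one_left (norm_nonneg _) (mul_le_one₀ (DirichletCharacter.norm_le_one χ1 _)
      (norm_nonneg _) (DirichletCharacter.norm_le_one χ2 _))).trans ?_
    simp
  have h2 : Summable fun p : ℤ × ℤ ↦ ‖if Int.gcd p.1 p.2 = 1 then
      χ1 p.1 * χ2 p.2 * ((p.1 : ℂ) * w + p.2) ^ (-(k : ℤ)) else 0‖ := by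
    refine Summable.of_nonneg_of_le (fun _ ↦ norm_nonneg _) (fun p ↦ ?_) hs
    split_ifs
    · exact le_rfl
    · rw [norm_zero]; exact norm_nonneg _
  rw [tsum_mul_tsum_of_summable_norm h1 h2]
  have hk0 : (k : ℤ) ≠ 0 := by omega
  have key (n : ℕ) (p : ℤ × ℤ) : (χ1 n * χ2 n * (n : ℂ) ^ (-(k : ℤ))) *
      (χ1 p.1 * χ2 p.2 * ((p.1 : ℂ) * w + p.2) ^ (-(k : ℤ))) =
      χ1 ((n * p.1 : ℤ)) * χ2 ((n * p.2 : ℤ)) *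
        (((n * p.1 : ℤ) : ℂ) * w + ((n * p.2 : ℤ) : ℂ)) ^ (-(k : ℤ)) := by
    have : (((n * p.1 : ℤ) : ℂ) * w + ((n * p.2 : ℤ) : ℂ)) = n * ((p.1 : ℂ) * w + p.2) := by
      push_cast; ring
    rw [this, mul_zpow]
    push_cast
    rw [map_mul, map_mul]
    ring
  have hg (p : ℤ × ℤ) : ((Int.gcd p.1 p.2 : ℤ) * (p.1 / Int.gcd p.1 p.2) = p.1) ∧
      ((Int.gcd p.1 p.2 : ℤ) * (p.2 / Int.gcd p.1 p.2) = p.2) :=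
    ⟨Int.mul_ediv_cancel' (Int.gcd_dvd_left ..), Int.mul_ediv_cancel' (Int.gcd_dvd_right ..)⟩
  refine tsum_eq_tsum_of_ne_zero_bij
    (fun p ↦ (Int.gcd p.1.1 p.1.2, (p.1.1 / Int.gcd p.1.1 p.1.2, p.1.2 / Int.gcd p.1.1 p.1.2)))
    ?_ ?_ ?_
  · rintro ⟨p, hp⟩ ⟨p', hp'⟩ h
    simp only [Prod.mk.injEq] at h
    obtain ⟨ha, hb, hc⟩ := h
    obtain ⟨e1, e2⟩ := hg p
    obtain ⟨e3, e4⟩ := hg p'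
    rw [Subtype.mk.injEq]
    ext
    · rw [← e1, ← e3, hb, ha]
    · rw [← e2, ← e4, hc, ha]
  · rintro ⟨n, p⟩ hp
    rw [Function.mem_support] at hp
    have hgcd : Int.gcd p.1 p.2 = 1 := by
      by_contra h
      exact hp (by simp [h])
    have hn : n ≠ 0 := by
      rintro rfl
      exact hp (by simp [zero_zpow _ (neg_ne_zero.mpr hk0)])
    simp only [hgcd, if_true] at hp
    rw [key] at hp
    have hg' : Int.gcd (n * p.1) (n * p.2) = n := by
      rw [Int.gcd_mul_left, hgcd]; simp
    have hn' : (n : ℤ) ≠ 0 := by exact_mod_cast hn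
    refine ⟨⟨(n * p.1, n * p.2), hp⟩, ?_⟩
    simp only [hg', Int.mul_ediv_cancel_left _ hn']
  · rintro ⟨p, hp⟩
    have hp0 : 0 < Int.gcd p.1 p.2 := by
      rw [Int.gcd_pos_iff]
      by_contra! h
      refine hp ?_
      simp [h.1, h.2, zero_zpow _ (neg_ne_zero.mpr hk0)]
    have : Int.gcd (p.1 / Int.gcd p.1 p.2) (p.2 / Int.gcd p.1 p.2) = 1 :=
      Int.gcd_ediv_gcd_ediv_gcd hp0
    simp only [this, if_true]
    rw [key (Int.gcd p.1 p.2) (p.1 / Int.gcd p.1 p.2, p.2 / Int.gcd p.1 p.2)]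
    simp only [hg p]

/-- Fourier expansion of the weight `k ≥ 3` holomorphic Eisenstein series attached to a pair of
primitive Dirichlet characters. -/
theorem holEisenstein_fourierExpansion {q1 q2 : ℕ} [NeZero q1] [NeZero q2]
    (k : ℕ) (hk : 3 ≤ k)
    (χ1 : DirichletCharacter ℂ q1) (χ2 : DirichletCharacter ℂ q2)
    (hprim1 : χ1.IsPrimitive) (hprim2 : χ2.IsPrimitive)
    (hparity : χ1 (-1) * χ2 (-1) = (-1 : ℂ) ^ k)
    (C : ℂ)
    (hC : C = ((q2 : ℂ) / (2 * Real.pi)) ^ k * (Nat.factorial (k - 1)) *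
      LSer ((DirichletCharacter.changeLevel (dvd_mul_right q1 q2) χ1) *
        (DirichletCharacter.changeLevel (dvd_mul_left q2 q1) χ2)) k)
    (z : ℂ) (hz : 0 < z.im) :
    C * holEisenstein k χ1 χ2 z =
      (if q1 = 1 then C else 0) +
        I ^ (-(k : ℤ)) * gaussSumChar χ2 *
          ∑' n : ℕ,
            (∑ d ∈ (n + 1).divisors,
              χ1 (((n + 1) / d : ℕ)) * (starRingEnd ℂ) (χ2 d) * (d : ℂ) ^ (k - 1)) *
              Complex.exp (2 * Real.pi * I * (n + 1) * z) := by
  have hk0 : (k : ℤ) ≠ 0 := by omega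
  have hq2 : (q2 : ℂ) ≠ 0 := by exact_mod_cast NeZero.ne q2
  have hL : LSer ((DirichletCharacter.changeLevel (dvd_mul_right q1 q2) χ1) *
        (DirichletCharacter.changeLevel (dvd_mul_left q2 q1) χ2)) k =
      ∑' n : ℕ, χ1 n * χ2 n * (n : ℂ) ^ (-(k : ℤ)) := by
    unfold LSer
    refine tsum_congr fun n ↦ ?_
    rw [aux_char_prod, ← Complex.cpow_intCast]
    push_cast; rfl
  set L := ∑' n : ℕ, χ1 n * χ2 n * (n : ℂ) ^ (-(k : ℤ)) with hLdef
  rw [hL] at hC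
  have hw : 0 < ((q2 : ℂ) * z).im := by
    have : (0 : ℝ) < q2 := by exact_mod_cast Nat.pos_of_ne_zero (NeZero.ne q2)
    simpa using mul_pos this hz
  have hcop := aux_coprime k hk χ1 χ2 (q2 * z) hw
  have hs := (aux_summable k hk χ1 χ2 (q2 * z) hw).of_norm
  have hpar (c d : ℤ) (u : ℂ) : χ1 ((-c : ℤ)) * χ2 ((-d : ℤ)) * (-u) ^ (-(k : ℤ)) =
      χ1 c * χ2 d * u ^ (-(k : ℤ)) := by
    push_cast
    rw [neg_eq_neg_one_mul (c : ZMod q1), neg_eq_neg_one_mul (d : ZMod q2), map_mul, map_mul,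
      neg_eq_neg_one_mul u, mul_zpow,
      show χ1 (-1) * χ1 c * (χ2 (-1) * χ2 d) * ((-1) ^ (-(k : ℤ)) * u ^ (-(k : ℤ))) =
      (χ1 (-1) * χ2 (-1)) * (-1) ^ (-(k : ℤ)) * (χ1 c * χ2 d * u ^ (-(k : ℤ))) by ring, hparity,
      zpow_neg, zpow_natCast, mul_inv_cancel₀ (pow_ne_zero _ (by norm_num)), one_mul]
  have hsplit : ∑' p : ℤ × ℤ, χ1 p.1 * χ2 p.2 * ((p.1 : ℂ) * (q2 * z) + p.2) ^ (-(k : ℤ)) =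
      ∑' d : ℤ, χ1 0 * χ2 d * (d : ℂ) ^ (-(k : ℤ)) +
      2 * ∑' c : ℕ+, χ1 ((c : ℕ) : ZMod q1) *
        ∑' d : ℤ, χ2 d * ((q2 : ℂ) * ((c : ℕ) * z) + d) ^ (-(k : ℤ)) := by
    rw [hs.tsum_prod, tsum_int_eq_zero_add_two_mul_tsum_pnat (fun n ↦ ?_) hs.prod]
    · rw [nsmul_eq_mul]
      simp only [Int.cast_zero, zero_mul, zero_add, Nat.cast_ofNat, Int.cast_natCast]
      congr 2
      refine tsum_congr fun c ↦ ?_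
      rw [← tsum_mul_left]
      refine tsum_congr fun d ↦ ?_
      rw [mul_assoc, show ((c : ℕ) : ℂ) * (q2 * z) = q2 * ((c : ℕ) * z) by ring]
    · rw [← tsum_comp_neg]
      refine tsum_congr fun d ↦ ?_
      simp only
      rw [← hpar n d]
      congr 2
      push_cast; ring
  have hzero : ∑' d : ℤ, χ1 0 * χ2 d * (d : ℂ) ^ (-(k : ℤ)) = if q1 = 1 then 2 * L else 0 := by
    split_ifs with h
    · subst h
      have hone (x : ZMod 1) : χ1 x = 1 := by
        rw [Subsingleton.elim x 1, map_one]
      have hsum : Summable fun d : ℤ ↦ χ1 0 * χ2 d * (d : ℂ) ^ (-(k : ℤ)) := by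
        have := hs.comp_injective (i := fun d : ℤ ↦ ((0 : ℤ), d)) (fun a b h ↦ by simpa using h)
        simpa [Function.comp_def] using this
      rw [tsum_int_eq_zero_add_two_mul_tsum_pnat (fun n ↦ ?_) hsum]
      · rw [nsmul_eq_mul, hLdef, tsum_eq_zero_add', tsum_pnat_eq_tsum_succ
          (f := fun n ↦ χ1 0 * χ2 (((n : ℕ) : ℤ) : ZMod q2) * (((n : ℕ) : ℤ) : ℂ) ^ (-(k : ℤ)))]
        · simp [hone, zero_pow (show k ≠ 0 by omega)]
        · have := hsum.comp_injective (i := fun n : ℕ ↦ ((n : ℤ) + 1))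
            (fun a b h ↦ by simpa using h)
          simpa [Function.comp_def, hone] using this
      · have := hpar 0 n (n : ℂ)
        simpa using this
    · have : ¬ IsUnit (0 : ZMod q1) := by
        have : Nontrivial (ZMod q1) := by
          have : Fact (1 < q1) := ⟨by have := NeZero.ne q1; omega⟩
          infer_instance
        exact not_isUnit_zero
      simp [MulChar.map_nonunit χ1 this]
  have hE : L * holEisenstein k χ1 χ2 z = (1 / 2) *
      ∑' p : ℤ × ℤ, χ1 p.1 * χ2 p.2 * ((p.1 : ℂ) * (q2 * z) + p.2) ^ (-(k : ℤ)) := by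
    rw [← hcop, holEisenstein]
    simp only [← mul_assoc]
    rw [hLdef]
    ring
  have hinner (c : ℕ+) := aux_inner k hk χ2 hprim2 ((c : ℕ) * z) (by
    have : (0 : ℝ) < (c : ℕ) := by exact_mod_cast c.pos
    simpa using mul_pos this hz)
  rw [← aux_double k χ1 χ2 z hz]
  set S := ∑' c : ℕ+, χ1 ((c : ℕ) : ZMod q1) *
      ∑' m : ℕ+, (starRingEnd ℂ) (χ2 ((m : ℕ) : ZMod q2)) * ((m : ℕ) : ℂ) ^ (k - 1) *
          Complex.exp (2 * Real.pi * I * ((c : ℕ) * z)) ^ (m : ℕ) with hS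
  have hS2 : ∑' c : ℕ+, χ1 ((c : ℕ) : ZMod q1) *
        ∑' d : ℤ, χ2 d * ((q2 : ℂ) * ((c : ℕ) * z) + d) ^ (-(k : ℤ)) =
      ((-2 * Real.pi * I) ^ k / (k - 1).factorial) * ((q2 : ℂ) ^ k)⁻¹ * gaussSumChar χ2 * S := by
    rw [hS, ← tsum_mul_left]
    refine tsum_congr fun c ↦ ?_
    rw [hinner c]
    ring
  have hconst : ((q2 : ℂ) / (2 * Real.pi)) ^ k * (Nat.factorial (k - 1)) *
      (((-2 * Real.pi * I) ^ k / (k - 1).factorial) * ((q2 : ℂ) ^ k)⁻¹) = I ^ (-(k : ℤ)) := by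
    have hf : ((k - 1).factorial : ℂ) ≠ 0 := by exact_mod_cast Nat.factorial_ne_zero _
    have hpi : (2 * Real.pi : ℂ) ≠ 0 := by simp [Real.pi_ne_zero]
    have hI : I ^ (-(k : ℤ)) = (-I) ^ k := by
      rw [zpow_neg, zpow_natCast, ← inv_pow, Complex.inv_I]
    rw [hI, show (-2 * Real.pi * I : ℂ) = (2 * Real.pi) * (-I) by ring, mul_pow, div_pow]
    have h1 := pow_ne_zero k hpi
    have h2 := pow_ne_zero k hq2
    field_simp
  rw [hC, mul_assoc _ L, hE, hsplit, hzero, hS2, ← hconst]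
  split_ifs <;> ring
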